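/- Let F be an exponential field with standard kernel satisfying the Schanuel Property, and let B ⊆ F be a subset of finite ℚ-linear dimension. Then there exists a strong ℚ-subspace of F containing B whose ℚ-linear dimension is finite; consequently the strong hull of B (the intersection of all strong ℚ-subspaces of F containing B ∪ ker(exp)) is finite-dimensional over ℚ. -/

import Mathlib

noncomputable section

/-- The subfield of `F` generated by `L ∪ exp(L)`. -/
def expField {F : Type*} [Field F] (exp : F → F) (L : Set F) : Subfield F :=
  Subfield.closure (L ∪ exp '' L)

/-- `L` is a *strong* ℚ-subspace of the exponential field `(F, exp)`: the kernel of `exp`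
is contained in `L`, and the relative predimension `δ(L'/L) ≥ 0` for every
finite-dimensional ℚ-subspace `L'` of `F`.  Concretely, for every finite tuple `a` which
is ℚ-linearly independent over `L` (i.e. a basis of some `L ⊔ L'` over `L`), the
transcendence degree over `K₁ = ℚ(L, exp L)` of `K₂ = ℚ(L₂, exp L₂)`, where
`L₂ = L ⊔ span(a)`, is at least the length of `a`; this is witnessed by a tuple of
elements of `K₂` which is algebraically independent over `K₁`. -/
def IsStrong {F : Type*} [Field F] [CharZero F] (exp : F → F) (L : Submodule ℚ F) : Prop :=
  {x : F | exp x = 1} ⊆ (L : Set F) ∧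
  ∀ (n : ℕ) (a : Fin n → F),
    LinearIndependent ℚ (fun i => (Submodule.Quotient.mk (a i) : F ⧸ L)) →
    ∃ t : Fin n → F,
      (∀ i, t i ∈ expField exp ((L ⊔ Submodule.span ℚ (Set.range a) : Submodule ℚ F) : Set F)) ∧
      AlgebraicIndependent (expField exp (L : Set F)) t

/-- The Schanuel Property for an exponential field `(F, exp)`: for all `z₁, …, zₙ ∈ F`,
`trdeg_ℚ(z₁, …, zₙ, exp z₁, …, exp zₙ) ≥ dim_ℚ Span_ℚ(z₁, …, zₙ)`; the transcendence
degree lower bound is witnessed by a tuple of that length, with entries in the subfield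
generated by the `zᵢ` and `exp zᵢ`, which is algebraically independent over `ℚ`. -/
def SchanuelProperty {F : Type*} [Field F] [CharZero F] (exp : F → F) : Prop :=
  ∀ (n : ℕ) (z : Fin n → F),
    ∃ t : Fin (Module.finrank ℚ (Submodule.span ℚ (Set.range z))) → F,
      (∀ i, t i ∈ Subfield.closure (Set.range z ∪ Set.range (exp ∘ z))) ∧
      AlgebraicIndependent ℚ t

open Cardinal

theorem expField_mono {F : Type*} [Field F] (exp : F → F) {L M : Set F} (h : L ⊆ M) :
    expField exp L ≤ expField exp M :=
  Subfield.closure_mono (Set.union_subset_union h (Set.image_mono h))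

section

variable {F : Type*} [Field F]

theorem exp_nsmul_of_map_add {exp : F → F} (hexp0 : exp 0 = 1)
    (hexpadd : ∀ x y : F, exp (x + y) = exp x * exp y) (n : ℕ) (x : F) :
    exp (n • x) = exp x ^ n := by
  induction n with
  | zero => simpa using hexp0
  | succ k ih => rw [succ_nsmul, hexpadd, ih, pow_succ]

theorem exp_zsmul_of_map_add {exp : F → F} (hexp0 : exp 0 = 1)
    (hexpadd : ∀ x y : F, exp (x + y) = exp x * exp y) (n : ℤ) (x : F) :
    exp (n • x) = exp x ^ n := by
  obtain ⟨k, rfl | rfl⟩ := n.eq_nat_or_neg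
  · simpa using exp_nsmul_of_map_add hexp0 hexpadd k x
  · have h := hexpadd (k • x) (-(k • x))
    rw [add_neg_cancel, hexp0, exp_nsmul_of_map_add hexp0 hexpadd] at h
    rw [neg_smul, zpow_neg, natCast_zsmul, zpow_natCast]
    exact eq_inv_of_mul_eq_one_right h.symm

variable [CharZero F]

/-- If the exponential of `x` lies in a relatively algebraically closed subfield, then so does the
exponential of every rational multiple of `x`. -/
theorem exp_rat_smul_mem_algebraicClosure {exp : F → F} (hexp0 : exp 0 = 1)
    (hexpadd : ∀ x y : F, exp (x + y) = exp x * exp y) (K : IntermediateField ℚ F) {x : F}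
    (hx : exp x ∈ algebraicClosure K F) (q : ℚ) : exp (q • x) ∈ algebraicClosure K F := by
  have h : exp (q • x) ^ q.den = exp x ^ q.num := by
    rw [← exp_nsmul_of_map_add hexp0 hexpadd, ← exp_zsmul_of_map_add hexp0 hexpadd]
    congr 1
    rw [← Nat.cast_smul_eq_nsmul ℚ, smul_smul, mul_comm, Rat.mul_den_eq_num,
      Int.cast_smul_eq_zsmul]
  rw [mem_algebraicClosure_iff]
  refine IsAlgebraic.of_pow q.den_pos ?_
  rw [h, ← mem_algebraicClosure_iff]
  exact zpow_mem hx _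

theorem trdeg_expField_lt_aleph0 {exp : F → F} (hexp0 : exp 0 = 1)
    (hexpadd : ∀ x y : F, exp (x + y) = exp x * exp y) (L : Submodule ℚ F)
    [FiniteDimensional ℚ L] : Algebra.trdeg ℚ (expField exp (L : Set F)) < ℵ₀ := by
  obtain ⟨s, hs⟩ := (Submodule.fg_iff_finiteDimensional L).2 inferInstance
  set K : IntermediateField ℚ F := IntermediateField.adjoin ℚ (s ∪ exp '' s : Set F) with hK
  have hmem (x : F) (hx : x ∈ L) :
      x ∈ algebraicClosure K F ∧ exp x ∈ algebraicClosure K F := by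
    rw [← hs] at hx
    have hKA (y : F) (hy : y ∈ K) : y ∈ algebraicClosure K F :=
      (algebraicClosure K F).algebraMap_mem ⟨y, hy⟩
    induction hx using Submodule.span_induction with
    | mem y hy =>
      exact ⟨hKA _ (IntermediateField.subset_adjoin _ _ (Or.inl hy)),
        hKA _ (IntermediateField.subset_adjoin _ _ (Or.inr ⟨y, hy, rfl⟩))⟩
    | zero => exact ⟨zero_mem _, hexp0 ▸ one_mem _⟩
    | add y z _ _ hy hz => exact ⟨add_mem hy.1 hz.1, hexpadd y z ▸ mul_mem hy.2 hz.2⟩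
    | smul q y _ hy =>
      refine ⟨?_, exp_rat_smul_mem_algebraicClosure hexp0 hexpadd K hy.2 q⟩
      rw [Algebra.smul_def]
      exact mul_mem (hKA _ (K.algebraMap_mem q)) hy.1
  have hle : expField exp (L : Set F) ≤ (algebraicClosure K F).toSubfield := by
    refine Subfield.closure_le.2 ?_
    rintro _ (hx | ⟨x, hx, rfl⟩)
    exacts [(hmem _ hx).1, (hmem _ hx).2]
  have hfg : K.FG := IntermediateField.fg_adjoin_of_finite
    (s.finite_toSet.union (s.finite_toSet.image exp))
  have : Algebra.EssFiniteType ℚ K := IntermediateField.essFiniteType_iff.2 hfg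
  have : FinTrdeg ℚ (algebraicClosure K F) := FinTrdeg.trans ℚ K _
  refine lt_of_le_of_lt ?_ (trdeg_lt_aleph0 ℚ (algebraicClosure K F))
  exact trdeg_le_of_injective (Subfield.inclusion hle).toRatAlgHom
    (Subfield.inclusion hle).injective

theorem SchanuelProperty.finrank_le_trdeg {exp : F → F} (hSP : SchanuelProperty exp)
    (L : Submodule ℚ F) [FiniteDimensional ℚ L] :
    (Module.finrank ℚ L : Cardinal) ≤ Algebra.trdeg ℚ (expField exp (L : Set F)) := by
  let b := Module.finBasis ℚ L
  have hspan : Submodule.span ℚ (Set.range fun i => (b i : F)) = L := by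
    rw [show (fun i => (b i : F)) = L.subtype ∘ b from rfl, Set.range_comp, Submodule.span_image,
      b.span_eq, Submodule.map_subtype_top]
  obtain ⟨t, ht, hti⟩ := hSP _ fun i => (b i : F)
  have hmem (i) : t i ∈ expField exp (L : Set F) := by
    refine Subfield.closure_mono ?_ (ht i)
    rintro _ (⟨j, rfl⟩ | ⟨j, rfl⟩)
    exacts [Or.inl (b j).2, Or.inr ⟨_, (b j).2, rfl⟩]
  have hti' : AlgebraicIndependent ℚ fun i => (⟨t i, hmem i⟩ : expField exp (L : Set F)) :=
    AlgebraicIndependent.of_comp (expField exp (L : Set F)).subtype.toRatAlgHom hti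
  have h := hti'.lift_cardinalMk_le_trdeg
  rw [hspan] at h
  simpa only [mk_fin, lift_natCast, lift_uzero] using h

theorem finrank_sup_span_of_linearIndependent_quotient {n : ℕ} (L : Submodule ℚ F)
    [FiniteDimensional ℚ L] (a : Fin n → F)
    (ha : LinearIndependent ℚ (fun i => (Submodule.Quotient.mk (a i) : F ⧸ L))) :
    Module.finrank ℚ (L ⊔ Submodule.span ℚ (Set.range a) : Submodule ℚ F) =
      Module.finrank ℚ L + n := by
  let b := Module.finBasis ℚ L
  have hspan : Submodule.span ℚ (Set.range fun i => (b i : F)) = L := by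
    rw [show (fun i => (b i : F)) = L.subtype ∘ b from rfl, Set.range_comp, Submodule.span_image,
      b.span_eq, Submodule.map_subtype_top]
  have h := finrank_span_eq_card (b.linearIndependent.sumElim_of_quotient a ha)
  rw [Set.Sum.elim_range, Submodule.span_union, hspan] at h
  simpa using h

/-- If the transcendence degrees of two nested subfields differ by at least `n`, then the larger
one contains `n` elements algebraically independent over the smaller one. -/
theorem exists_algebraicIndependent_of_trdeg_add_le {K M : Subfield F} (hKM : K ≤ M) {n : ℕ}
    (hfin : Algebra.trdeg ℚ K < ℵ₀) (h : Algebra.trdeg ℚ K + n ≤ Algebra.trdeg ℚ M) :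
    ∃ t : Fin n → F, (∀ i, t i ∈ M) ∧ AlgebraicIndependent K t := by
  let _ : Algebra K M := (Subfield.inclusion hKM).toAlgebra
  have : IsScalarTower K M F := .of_algebraMap_eq fun _ => rfl
  rw [← trdeg_add_eq ℚ K (A := M), add_comm, add_comm (Algebra.trdeg ℚ K),
    add_le_add_iff_of_lt_aleph0 hfin] at h
  obtain ⟨s, hs⟩ := exists_isTranscendenceBasis K M
  rw [← hs.cardinalMk_eq_trdeg] at h
  obtain ⟨f⟩ : Nonempty (Fin n ↪ s) := by
    rw [← Cardinal.lift_mk_le']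
    simpa using h
  refine ⟨fun i => ((f i : M) : F), fun i => (f i : M).2, ?_⟩
  exact (hs.1.comp f f.injective).map' (f := IsScalarTower.toAlgHom K M F)
    (algebraMap M F).injective

/-- Every finite-dimensional subspace lies in a finite-dimensional subspace of minimal
predimension, and such a subspace is strong as soon as it contains the kernel. -/
theorem SchanuelProperty.exists_isStrong_ge {exp : F → F} (hSP : SchanuelProperty exp)
    (hexp0 : exp 0 = 1) (hexpadd : ∀ x y : F, exp (x + y) = exp x * exp y)
    (L₀ : Submodule ℚ F) [FiniteDimensional ℚ L₀] (hker : {x : F | exp x = 1} ⊆ (L₀ : Set F)) :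
    ∃ L : Submodule ℚ F, IsStrong exp L ∧ L₀ ≤ L ∧ FiniteDimensional ℚ L := by
  classical
  let P (m : ℕ) : Prop := ∃ L : Submodule ℚ F, L₀ ≤ L ∧ FiniteDimensional ℚ L ∧
    Algebra.trdeg ℚ (expField exp (L : Set F)) ≤ (Module.finrank ℚ L + m : ℕ)
  have hP : ∃ m, P m := by
    obtain ⟨m, hm⟩ := Cardinal.lt_aleph0.1 (trdeg_expField_lt_aleph0 hexp0 hexpadd L₀)
    exact ⟨m, L₀, le_rfl, inferInstance, by rw [hm]; exact_mod_cast Nat.le_add_left _ _⟩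
  obtain ⟨L, hL, hfd, hle⟩ := Nat.find_spec hP
  refine ⟨L, ⟨hker.trans hL, fun n a ha => ?_⟩, hL, hfd⟩
  set M : Submodule ℚ F := L ⊔ Submodule.span ℚ (Set.range a) with hM
  have : FiniteDimensional ℚ (Submodule.span ℚ (Set.range a)) :=
    FiniteDimensional.span_of_finite ℚ (Set.finite_range a)
  have hMfd : FiniteDimensional ℚ M := Submodule.finiteDimensional_sup _ _
  have hrank : Module.finrank ℚ M = Module.finrank ℚ L + n :=
    finrank_sup_span_of_linearIndependent_quotient L a ha
  have hLM : L ≤ M := le_sup_left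
  have hfin := trdeg_expField_lt_aleph0 hexp0 hexpadd L
  refine exists_algebraicIndependent_of_trdeg_add_le (expField_mono exp hLM) hfin ?_
  obtain ⟨c, hc⟩ := Cardinal.lt_aleph0.1 hfin
  obtain ⟨d, hd⟩ := Cardinal.lt_aleph0.1 (trdeg_expField_lt_aleph0 hexp0 hexpadd M)
  have hschanuel := hSP.finrank_le_trdeg M
  rw [hd] at hschanuel ⊢
  rw [hc] at hle ⊢
  norm_cast at hle hschanuel ⊢
  have hmin : Nat.find hP ≤ d - Module.finrank ℚ M :=
    Nat.find_min' hP ⟨M, hL.trans hLM, hMfd, by rw [hd]; exact_mod_cast by omega⟩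
  omega

end

/-- **Finite-dimensional sets have finite-dimensional strong hulls.** If `F` is an
exponential field with standard kernel `ℤτ` (`τ` transcendental over `ℚ`) satisfying the
Schanuel Property, and `B ⊆ F` has finite ℚ-linear dimension, then there is a
finite-dimensional strong ℚ-subspace of `F` containing `B`; consequently the strong hull
of `B` (the intersection of all strong ℚ-subspaces containing `B ∪ ker(exp)`) is
finite-dimensional over `ℚ`. -/
theorem hull_finiteDimensional {F : Type*} [Field F] [CharZero F] (exp : F → F)
    (hexp0 : exp 0 = 1) (hexpadd : ∀ x y : F, exp (x + y) = exp x * exp y)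
    (τ : F) (hτ : Transcendental ℚ τ)
    (hker : {x : F | exp x = 1} = {x : F | ∃ k : ℤ, x = k • τ})
    (hSP : SchanuelProperty exp)
    (B : Set F) (hB : FiniteDimensional ℚ (Submodule.span ℚ B)) :
    (∃ L : Submodule ℚ F, IsStrong exp L ∧ B ⊆ (L : Set F) ∧ FiniteDimensional ℚ L) ∧
    FiniteDimensional ℚ ↥
      (sInf {L : Submodule ℚ F | IsStrong exp L ∧ B ∪ {x : F | exp x = 1} ⊆ (L : Set F)}) := by
  have hfd : FiniteDimensional ℚ (Submodule.span ℚ B ⊔ Submodule.span ℚ {τ} : Submodule ℚ F) :=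
    Submodule.finiteDimensional_sup _ _
  obtain ⟨L, hL, hle, hLfd⟩ := hSP.exists_isStrong_ge hexp0 hexpadd
    (Submodule.span ℚ B ⊔ Submodule.span ℚ {τ}) (by
      rw [hker]
      rintro _ ⟨k, rfl⟩
      exact zsmul_mem (le_sup_right (a := Submodule.span ℚ B)
        (Submodule.mem_span_singleton_self τ)) k)
  have hBL : B ⊆ (L : Set F) := Submodule.span_le.1 (le_sup_left.trans hle)
  exact ⟨⟨L, hL, hBL, hLfd⟩, Submodule.finiteDimensional_of_le
    (sInf_le (a := L) ⟨hL, Set.union_subset hBL hL.1⟩)⟩
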